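/- There exists a constant C > 0 such that for all integers n ≥ 3, a(n) ≥ (8/27)n⁴ − (40/27)n³ − C·n². -/

import Mathlib

/-- The grid `A_n = {(x,y) ∈ ℤ² : 1 ≤ x, y ≤ n}`. -/
def gridSet (n : ℕ) : Set (ℤ × ℤ) :=
  {p | 1 ≤ p.1 ∧ p.1 ≤ (n : ℤ) ∧ 1 ≤ p.2 ∧ p.2 ≤ (n : ℤ)}

/-- The embedding of an integer lattice point into the real plane. -/
def toR2 (p : ℤ × ℤ) : ℝ × ℝ := ((p.1 : ℝ), (p.2 : ℝ))

/-- Squared Euclidean distance between two lattice points, as a natural number. -/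
def sqLen (p q : ℤ × ℤ) : ℕ := (q.1 - p.1).natAbs ^ 2 + (q.2 - p.2).natAbs ^ 2

/-- `f : ZMod (n²) → ℤ × ℤ` is a simple closed grid polygon on `A_n`:
it is a bijection onto `A_n`, and any two distinct (closed) edges of the closed
polygonal curve `f 0, f 1, …, f (n²-1), f 0` meet only in common endpoints. -/
structure IsSimpleClosedGridPolygon (n : ℕ) (f : ZMod (n ^ 2) → ℤ × ℤ) : Prop where
  inj : Function.Injective f
  range_eq : Set.range f = gridSet n
  simple : ∀ i j : ZMod (n ^ 2), i ≠ j →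
    segment ℝ (toR2 (f i)) (toR2 (f (i + 1))) ∩
        segment ℝ (toR2 (f j)) (toR2 (f (j + 1))) ⊆
      ({toR2 (f i), toR2 (f (i + 1))} : Set (ℝ × ℝ)) ∩
        ({toR2 (f j), toR2 (f (j + 1))} : Set (ℝ × ℝ))

/-- The weight `s(f)`: sum of the squared Euclidean side lengths. -/
def polyWeight (n : ℕ) (f : ZMod (n ^ 2) → ℤ × ℤ) : ℕ :=
  ∑ i ∈ Finset.range (n ^ 2), sqLen (f (i : ZMod (n ^ 2))) (f ((i : ZMod (n ^ 2)) + 1))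

/-- `a(n)`: the maximal weight of a simple closed grid polygon on `A_n`. -/
noncomputable def polyA (n : ℕ) : ℕ :=
  sSup {w : ℕ | ∃ f, IsSimpleClosedGridPolygon n f ∧ polyWeight n f = w}

/-- A grid polygon is proper if no three consecutive vertices are collinear. -/
def IsProper (n : ℕ) (f : ZMod (n ^ 2) → ℤ × ℤ) : Prop :=
  ∀ i : ZMod (n ^ 2),
    ¬ Collinear ℝ ({toR2 (f i), toR2 (f (i + 1)), toR2 (f (i + 2))} : Set (ℝ × ℝ))

/-- `a₀(n)`: the maximal weight of a proper simple closed grid polygon on `A_n`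
(the supremum in `ℕ`, equal to `0` if no proper polygon exists). -/
noncomputable def polyA0 (n : ℕ) : ℕ :=
  sSup {w : ℕ | ∃ f, IsSimpleClosedGridPolygon n f ∧ IsProper n f ∧ polyWeight n f = w}

/-- A directed edge of one unit to the right. -/
def IsHorizontalStep (p q : ℤ × ℤ) : Prop := q.2 = p.2 ∧ q.1 = p.1 + 1

/-- A directed edge from one row to the next, whose endpoints are related by `A`. -/
def IsUpwardStep (A : ℤ → ℤ → ℤ → Prop) (p q : ℤ × ℤ) : Prop := q.2 = p.2 + 1 ∧ A p.2 p.1 q.1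

/-- A directed edge which is horizontal of unit length to the right, or climbs one row. -/
def IsStep (A : ℤ → ℤ → ℤ → Prop) (p q : ℤ × ℤ) : Prop :=
  IsHorizontalStep p q ∨ IsUpwardStep A p q

lemma mem_segment_toR2 {p q : ℤ × ℤ} {z : ℝ × ℝ} (hz : z ∈ segment ℝ (toR2 p) (toR2 q)) :
    ∃ t : ℝ, 0 ≤ t ∧ t ≤ 1 ∧ z.1 = p.1 + t * (q.1 - p.1) ∧ z.2 = p.2 + t * (q.2 - p.2) := by
  obtain ⟨a, b, ha, hb, hab, rfl⟩ := hz
  obtain rfl : a = 1 - b := by linarith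
  refine ⟨b, hb, by linarith, ?_, ?_⟩ <;> simp [toR2] <;> ring

lemma eq_toR2 {z : ℝ × ℝ} {p : ℤ × ℤ} (h₁ : z.1 = p.1) (h₂ : z.2 = p.2) : z = toR2 p :=
  Prod.ext h₁ h₂

lemma inter_horizontal_horizontal {p q p' q' : ℤ × ℤ} (h : IsHorizontalStep p q)
    (h' : IsHorizontalStep p' q') (hne : (p, q) ≠ (p', q')) {z : ℝ × ℝ}
    (hz : z ∈ segment ℝ (toR2 p) (toR2 q)) (hz' : z ∈ segment ℝ (toR2 p') (toR2 q')) :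
    (z = toR2 p ∨ z = toR2 q) ∧ (z = toR2 p' ∨ z = toR2 q') := by
  obtain ⟨x, y⟩ := p
  obtain ⟨x₁, y₁⟩ := q
  obtain ⟨x', y'⟩ := p'
  obtain ⟨x₁', y₁'⟩ := q'
  obtain ⟨h1, h2⟩ := h
  obtain ⟨h1', h2'⟩ := h'
  simp only at h1 h2 h1' h2'
  subst h1 h2 h1' h2'
  obtain ⟨t, t0, t1, hx, hy⟩ := mem_segment_toR2 hz
  obtain ⟨t', t0', t1', hx', hy'⟩ := mem_segment_toR2 hz'
  push_cast at hx hx' hy hy'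
  have hyy : (y₁ : ℝ) = y₁' := by linarith
  have hyy' : y₁ = y₁' := by exact_mod_cast hyy
  subst hyy'
  rcases lt_trichotomy x x' with hlt | rfl | hlt
  · have : (x : ℝ) + 1 ≤ x' := by exact_mod_cast hlt
    refine ⟨.inr (eq_toR2 ?_ ?_), .inl (eq_toR2 ?_ ?_)⟩ <;> push_cast <;> linarith
  · exact absurd rfl hne
  · have : (x' : ℝ) + 1 ≤ x := by exact_mod_cast hlt
    refine ⟨.inl (eq_toR2 ?_ ?_), .inr (eq_toR2 ?_ ?_)⟩ <;> push_cast <;> linarith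

lemma inter_horizontal_upward {A : ℤ → ℤ → ℤ → Prop} {p q p' q' : ℤ × ℤ}
    (h : IsHorizontalStep p q) (h' : IsUpwardStep A p' q') {z : ℝ × ℝ}
    (hz : z ∈ segment ℝ (toR2 p) (toR2 q)) (hz' : z ∈ segment ℝ (toR2 p') (toR2 q')) :
    (z = toR2 p ∨ z = toR2 q) ∧ (z = toR2 p' ∨ z = toR2 q') := by
  obtain ⟨x, y⟩ := p
  obtain ⟨x₁, y₁⟩ := q
  obtain ⟨a, y'⟩ := p'
  obtain ⟨b, y₁'⟩ := q'
  obtain ⟨h1, h2⟩ := h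
  obtain ⟨h1', -⟩ := h'
  simp only at h1 h2 h1'
  subst h1 h2 h1'
  obtain ⟨t, t0, t1, hx, hy⟩ := mem_segment_toR2 hz
  obtain ⟨t', t0', t1', hx', hy'⟩ := mem_segment_toR2 hz'
  push_cast at hx hx' hy hy'
  have ht' : t' = ((y₁ - y' : ℤ) : ℝ) := by push_cast; linarith
  have k0 : 0 ≤ y₁ - y' := by rw [ht'] at t0'; exact_mod_cast t0'
  have k1 : y₁ - y' ≤ 1 := by rw [ht'] at t1'; exact_mod_cast t1'
  have key : ∀ c : ℤ, z.1 = c → z = toR2 (x, y₁) ∨ z = toR2 (x + 1, y₁) := by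
    intro c hc
    have e1 : (x : ℝ) ≤ c := by linarith
    have e2 : (c : ℝ) ≤ x + 1 := by linarith
    have e1' : x ≤ c := by exact_mod_cast e1
    have e2' : c ≤ x + 1 := by exact_mod_cast e2
    have : c = x ∨ c = x + 1 := by omega
    rcases this with rfl | rfl
    · exact .inl (eq_toR2 hc (by simp only; linarith))
    · exact .inr (eq_toR2 hc (by simp only; linarith))
  have : y₁ - y' = 0 ∨ y₁ - y' = 1 := by omega
  rcases this with hk | hk <;> rw [hk] at ht' <;> push_cast at ht' <;> subst ht'
  · have hz1 : z.1 = a := by linarith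
    exact ⟨key a hz1, .inl (eq_toR2 hz1 (by simp only; linarith))⟩
  · have hz1 : z.1 = b := by linarith
    exact ⟨key b hz1, .inr (eq_toR2 hz1 (by push_cast; linarith))⟩

lemma inter_upward_upward {A : ℤ → ℤ → ℤ → Prop}
    (hA : ∀ y a b a' b', A y a b → A y a' b' → 0 ≤ (a - a') * (b - b')) {p q p' q' : ℤ × ℤ}
    (h : IsUpwardStep A p q) (h' : IsUpwardStep A p' q') (hne : (p, q) ≠ (p', q')) {z : ℝ × ℝ}
    (hz : z ∈ segment ℝ (toR2 p) (toR2 q)) (hz' : z ∈ segment ℝ (toR2 p') (toR2 q')) :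
    (z = toR2 p ∨ z = toR2 q) ∧ (z = toR2 p' ∨ z = toR2 q') := by
  obtain ⟨a, y⟩ := p
  obtain ⟨b, y₁⟩ := q
  obtain ⟨a', y'⟩ := p'
  obtain ⟨b', y₁'⟩ := q'
  obtain ⟨h1, h2⟩ := h
  obtain ⟨h1', h2'⟩ := h'
  simp only at h1 h2 h1' h2'
  subst h1 h1'
  obtain ⟨t, t0, t1, hx, hy⟩ := mem_segment_toR2 hz
  obtain ⟨t', t0', t1', hx', hy'⟩ := mem_segment_toR2 hz'
  push_cast at hx hx' hy hy'
  rcases lt_trichotomy y y' with hlt | rfl | hlt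
  · have : (y : ℝ) + 1 ≤ y' := by exact_mod_cast hlt
    obtain rfl : t = 1 := by linarith
    obtain rfl : t' = 0 := by linarith
    refine ⟨.inr (eq_toR2 ?_ ?_), .inl (eq_toR2 ?_ ?_)⟩ <;> push_cast <;> linarith
  · obtain rfl : t = t' := by linarith
    have hm := hA _ _ _ _ _ h2 h2'
    have hmR : (0 : ℝ) ≤ ((a : ℝ) - a') * (b - b') := by exact_mod_cast hm
    have hz0 : (1 - t) * ((a : ℝ) - a') + t * (b - b') = 0 := by linarith
    rcases eq_or_lt_of_le t0 with rfl | t0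
    · refine ⟨.inl (eq_toR2 ?_ ?_), .inl (eq_toR2 ?_ ?_)⟩ <;> push_cast <;> linarith
    rcases eq_or_lt_of_le t1 with rfl | t1
    · refine ⟨.inr (eq_toR2 ?_ ?_), .inr (eq_toR2 ?_ ?_)⟩ <;> push_cast <;> linarith
    have s0 : 0 < 1 - t := by linarith
    have hsum : (1 - t) ^ 2 * ((a : ℝ) - a') ^ 2 + t ^ 2 * ((b : ℝ) - b') ^ 2 ≤ 0 := by
      have hp := mul_nonneg (mul_pos s0 t0).le hmR
      have hsq : ((1 - t) * ((a : ℝ) - a') + t * (b - b')) ^ 2 = 0 := by rw [hz0]; ring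
      nlinarith
    have ha : (a : ℝ) - a' = 0 := by
      by_contra hne0
      have := mul_pos (pow_pos s0 2) (pow_pos (abs_pos.2 hne0) 2)
      rw [sq_abs] at this
      have := mul_nonneg (sq_nonneg t) (sq_nonneg ((b : ℝ) - b'))
      linarith
    have hb : (b : ℝ) - b' = 0 := by
      rw [ha, mul_zero, zero_add] at hz0
      exact (mul_eq_zero.1 hz0).resolve_left t0.ne'
    have ha' : a = a' := by exact_mod_cast sub_eq_zero.1 ha
    have hb' : b = b' := by exact_mod_cast sub_eq_zero.1 hb
    exact absurd (by rw [ha', hb']) hne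
  · have : (y' : ℝ) + 1 ≤ y := by exact_mod_cast hlt
    obtain rfl : t' = 1 := by linarith
    obtain rfl : t = 0 := by linarith
    refine ⟨.inl (eq_toR2 ?_ ?_), .inr (eq_toR2 ?_ ?_)⟩ <;> push_cast <;> linarith

lemma inter_steps {A : ℤ → ℤ → ℤ → Prop}
    (hA : ∀ y a b a' b', A y a b → A y a' b' → 0 ≤ (a - a') * (b - b')) {p q p' q' : ℤ × ℤ}
    (h : IsStep A p q) (h' : IsStep A p' q') (hne : (p, q) ≠ (p', q')) :
    segment ℝ (toR2 p) (toR2 q) ∩ segment ℝ (toR2 p') (toR2 q') ⊆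
      ({toR2 p, toR2 q} : Set (ℝ × ℝ)) ∩ ({toR2 p', toR2 q'} : Set (ℝ × ℝ)) := by
  rintro z ⟨hz, hz'⟩
  rcases h with h | h <;> rcases h' with h' | h'
  · exact inter_horizontal_horizontal h h' hne hz hz'
  · exact inter_horizontal_upward h h' hz hz'
  · exact (inter_horizontal_upward h' h hz' hz).symm
  · exact inter_upward_upward hA h h' hne hz hz'

/-- A closed path through the whole grid whose edges are unit horizontal steps or steps between
adjacent rows is simple as soon as the steps between any two adjacent rows are ordered. -/
lemma isSimpleClosedGridPolygon_of_steps {n : ℕ} (hn : 2 ≤ n) {f : ZMod (n ^ 2) → ℤ × ℤ}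
    (hinj : Function.Injective f) (hrange : Set.range f = gridSet n) {A : ℤ → ℤ → ℤ → Prop}
    (hA : ∀ y a b a' b', A y a b → A y a' b' → 0 ≤ (a - a') * (b - b'))
    (hstep : ∀ i, IsStep A (f i) (f (i + 1)) ∨ IsStep A (f (i + 1)) (f i)) :
    IsSimpleClosedGridPolygon n f := by
  refine ⟨hinj, hrange, fun i j hij => ?_⟩
  have two_ne : (2 : ZMod (n ^ 2)) ≠ 0 := by
    intro h
    have h2 : n ^ 2 ∣ 2 := (ZMod.natCast_eq_zero_iff 2 (n ^ 2)).1 (by exact_mod_cast h)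
    have := Nat.le_of_dvd two_pos h2
    nlinarith
  have hfwd : f i ≠ f j := hinj.ne hij
  have hrev : ¬ (f i = f (j + 1) ∧ f (i + 1) = f j) := by
    rintro ⟨h1, h2⟩
    have h1 := hinj h1
    have h2 := hinj h2
    rw [h1, add_assoc, one_add_one_eq_two] at h2
    exact two_ne (by simpa using h2)
  rcases hstep i with hi | hi <;> rcases hstep j with hj | hj
  · exact inter_steps hA hi hj fun h => hfwd (Prod.ext_iff.1 h).1
  · rw [segment_symm ℝ (toR2 (f j)), Set.pair_comm (toR2 (f j))]
    exact inter_steps hA hi hj fun h => hrev (Prod.ext_iff.1 h)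
  · rw [segment_symm ℝ (toR2 (f i)), Set.pair_comm (toR2 (f i))]
    exact inter_steps hA hi hj fun h => hrev (Prod.ext_iff.1 h).symm
  · rw [segment_symm ℝ (toR2 (f i)), Set.pair_comm (toR2 (f i)), segment_symm ℝ (toR2 (f j)),
      Set.pair_comm (toR2 (f j))]
    exact inter_steps hA hi hj fun h => hfwd (Prod.ext_iff.1 h).2

/-- The `j`-th vertex of the zigzag between the leftmost `m` points of row `y` and the rightmost
`m` points of row `y + 1` (among `w` columns), followed by the middle points of row `y + 1`. -/
def zigzagBlock (w m y j : ℕ) : ℤ × ℤ :=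
  if j < 2 * m then
    if j % 2 = 0 then ((m : ℤ) - (j / 2 : ℕ), (y : ℤ)) else ((w : ℤ) - (j / 2 : ℕ), (y : ℤ) + 1)
  else ((w : ℤ) + m - j, (y : ℤ) + 1)

/-- The `k`-th vertex of the zigzag polygon on the grid of side `w + 1`. It climbs through the
`w × w` grid by zigzags and returns along the top row and the rightmost column. -/
def zigzag (w m k : ℕ) : ℤ × ℤ :=
  if k + m < w then ((w : ℤ) - k, 1)
  else if k + m < w * w then zigzagBlock w m ((k + m) / w) ((k + m) % w)
  else if k < w * w then (((w * w : ℕ) : ℤ) - k, (w : ℤ))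
  else if k ≤ w * w + w then ((k : ℤ) - (w * w : ℕ) + 1, (w : ℤ) + 1)
  else ((w : ℤ) + 1, (w * w : ℕ) + 2 * (w : ℤ) + 1 - k)

/-- The pairs of horizontal coordinates allowed for the steps of the zigzag polygon that climb
from row `y` to row `y + 1`. -/
def zigzagRel (w m : ℕ) (y a b : ℤ) : Prop :=
  (y < w ∧ (((w : ℤ) - m ≤ b - a ∧ b - a ≤ (w : ℤ) - m + 1 ∧ a ≤ w + 1 ∧ b ≤ w + 1) ∨
    (a = w + 1 ∧ b = w + 1))) ∨ (y = w ∧ a = b)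

lemma zigzagRel_ordered (w m : ℕ) (y a b a' b' : ℤ) (h : zigzagRel w m y a b)
    (h' : zigzagRel w m y a' b') : 0 ≤ (a - a') * (b - b') := by
  unfold zigzagRel at h h'
  rcases lt_trichotomy a a' with hlt | rfl | hlt
  · exact mul_nonneg_of_nonpos_of_nonpos (by omega) (by omega)
  · simp
  · exact mul_nonneg (by omega) (by omega)

lemma zigzag_of_lt {w m k : ℕ} (h : k + m < w) : zigzag w m k = ((w : ℤ) - k, 1) := by
  simp [zigzag, h]

lemma zigzag_block {w m y j k : ℕ} (hy : 1 ≤ y) (hyw : y < w) (hj : j < w)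
    (hk : k + m = y * w + j) : zigzag w m k = zigzagBlock w m y j := by
  have h1 : ¬ k + m < w := by nlinarith
  have h2 : k + m < w * w := by nlinarith
  have h3 : (k + m) / w = y := by
    rw [hk, mul_comm, Nat.mul_add_div (by omega), Nat.div_eq_of_lt hj, add_zero]
  have h4 : (k + m) % w = j := by
    rw [hk, mul_comm, Nat.mul_add_mod, Nat.mod_eq_of_lt hj]
  rw [zigzag, if_neg h1, if_pos h2, h3, h4]

lemma zigzag_lastRow {w m k : ℕ} (hw : 1 ≤ w) (h1 : w * w ≤ k + m) (h2 : k < w * w) :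
    zigzag w m k = (((w * w : ℕ) : ℤ) - k, (w : ℤ)) := by
  have : w ≤ w * w := by nlinarith
  rw [zigzag, if_neg (by omega), if_neg (by omega), if_pos h2]

lemma zigzag_topRow {w m k : ℕ} (hw : 1 ≤ w) (h1 : w * w ≤ k) (h2 : k ≤ w * w + w) :
    zigzag w m k = ((k : ℤ) - (w * w : ℕ) + 1, (w : ℤ) + 1) := by
  have : w ≤ w * w := by nlinarith
  rw [zigzag, if_neg (by omega), if_neg (by omega), if_neg (by omega), if_pos h2]

lemma zigzag_lastColumn {w m k : ℕ} (hw : 1 ≤ w) (h : w * w + w < k) :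
    zigzag w m k = ((w : ℤ) + 1, (w * w : ℕ) + 2 * (w : ℤ) + 1 - k) := by
  have : w ≤ w * w := by nlinarith
  rw [zigzag, if_neg (by omega), if_neg (by omega), if_neg (by omega), if_neg (by omega)]

lemma exists_block {w t : ℕ} (hw : 1 ≤ w) (h1 : w ≤ t) (h2 : t < w * w) :
    ∃ y j, 1 ≤ y ∧ y < w ∧ j < w ∧ t = y * w + j :=
  ⟨t / w, t % w, (Nat.one_le_div_iff hw).2 h1, Nat.div_lt_of_lt_mul h2, Nat.mod_lt _ hw,
    (Nat.div_add_mod' t w).symm⟩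

lemma zigzagBlock_step {w m y j : ℕ} (hm : 1 ≤ m) (hmw : 3 * m ≤ w) (hyw : y < w)
    (hj : j + 1 < w) :
    IsStep (zigzagRel w m) (zigzagBlock w m y j) (zigzagBlock w m y (j + 1)) ∨
      IsStep (zigzagRel w m) (zigzagBlock w m y (j + 1)) (zigzagBlock w m y j) := by
  unfold zigzagBlock IsStep IsHorizontalStep IsUpwardStep zigzagRel
  split_ifs <;> simp only [true_and] <;> omega

lemma zigzagBlock_last {w m y : ℕ} (hm : 1 ≤ m) (hmw : 3 * m ≤ w) :
    zigzagBlock w m y (w - 1) = ((m : ℤ) + 1, (y : ℤ) + 1) := by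
  rw [zigzagBlock, if_neg (by omega)]
  ext <;> simp only
  omega

lemma zigzagBlock_zero {w m y : ℕ} (hm : 1 ≤ m) :
    zigzagBlock w m y 0 = ((m : ℤ), (y : ℤ)) := by
  rw [zigzagBlock, if_pos (by omega)]
  simp

lemma zigzag_step {w m k : ℕ} (hm : 1 ≤ m) (hmw : 3 * m ≤ w) (hk : k + 1 < (w + 1) ^ 2) :
    IsStep (zigzagRel w m) (zigzag w m k) (zigzag w m (k + 1)) ∨
      IsStep (zigzagRel w m) (zigzag w m (k + 1)) (zigzag w m k) := by
  have hw : 1 ≤ w := by omega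
  have hww : 3 * w ≤ w * w := Nat.mul_le_mul_right w (by omega)
  have hk' : k + 1 < w * w + 2 * w + 1 := by linarith [hk, sq (w + 1)]
  by_cases c1 : k + m < w
  · rw [zigzag_of_lt c1]
    by_cases c1' : k + 1 + m < w
    · rw [zigzag_of_lt c1']
      unfold IsStep IsHorizontalStep
      simp only [true_and]
      omega
    · rw [zigzag_block (y := 1) (j := 0) le_rfl (by omega) (by omega) (by omega),
        zigzagBlock_zero hm]
      unfold IsStep IsHorizontalStep
      simp only
      omega
  by_cases c2 : k + m < w * w
  · obtain ⟨y, j, hy, hyw, hj, hyj⟩ := exists_block hw (by omega) c2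
    rw [zigzag_block hy hyw hj hyj]
    by_cases cj : j + 1 < w
    · rw [zigzag_block hy hyw cj (by omega)]
      exact zigzagBlock_step hm hmw hyw cj
    · obtain rfl : j = w - 1 := by omega
      have hnext : k + 1 + m = (y + 1) * w + 0 := by rw [add_mul]; omega
      have hval : zigzag w m (k + 1) = ((m : ℤ), (y : ℤ) + 1) := by
        by_cases cy : y + 1 < w
        · rw [zigzag_block (by omega) cy (by omega) hnext, zigzagBlock_zero hm]
          push_cast
          rfl
        · have hyw' : y + 1 = w := by omega
          rw [hyw'] at hnext
          rw [zigzag_lastRow hw (by omega) (by omega)]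
          ext <;> simp only <;> omega
      rw [hval, zigzagBlock_last hm hmw]
      exact .inr (.inl ⟨rfl, rfl⟩)
  by_cases c3 : k < w * w
  · rw [zigzag_lastRow hw (by omega) c3]
    by_cases c3' : k + 1 < w * w
    · rw [zigzag_lastRow hw (by omega) c3']
      unfold IsStep IsHorizontalStep
      simp only [true_and]
      omega
    · rw [zigzag_topRow hw (by omega) (by omega)]
      unfold IsStep IsUpwardStep zigzagRel
      simp only [true_and]
      omega
  by_cases c4 : k ≤ w * w + w
  · rw [zigzag_topRow hw (by omega) c4]
    by_cases c4' : k + 1 ≤ w * w + w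
    · rw [zigzag_topRow hw (by omega) c4']
      unfold IsStep IsHorizontalStep
      simp only [true_and]
      omega
    · rw [zigzag_lastColumn hw (by omega)]
      unfold IsStep IsUpwardStep zigzagRel
      simp only [true_and, and_true]
      omega
  · rw [zigzag_lastColumn hw (by omega), zigzag_lastColumn hw (by omega)]
    unfold IsStep IsUpwardStep zigzagRel
    simp only [and_self, or_true, and_true]
    omega

lemma zigzag_step_last {w m : ℕ} (hm : 1 ≤ m) (hmw : 3 * m ≤ w) :
    IsStep (zigzagRel w m) (zigzag w m 0) (zigzag w m ((w + 1) ^ 2 - 1)) := by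
  have hsq : (w + 1) ^ 2 = w * w + 2 * w + 1 := by ring
  rw [hsq, zigzag_of_lt (by omega), zigzag_lastColumn (by omega) (by omega)]
  unfold IsStep IsHorizontalStep
  simp only
  omega

lemma zigzag_mem {w m k : ℕ} (hm : 1 ≤ m) (hmw : 3 * m ≤ w) (hk : k < (w + 1) ^ 2) :
    zigzag w m k ∈ gridSet (w + 1) := by
  have hw : 1 ≤ w := by omega
  have hww : 3 * w ≤ w * w := Nat.mul_le_mul_right w (by omega)
  have hk' : k < w * w + 2 * w + 1 := by linarith [hk, sq (w + 1)]
  unfold gridSet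
  rw [Set.mem_ofPred_eq]
  by_cases c1 : k + m < w
  · rw [zigzag_of_lt c1]
    simp only
    omega
  by_cases c2 : k + m < w * w
  · obtain ⟨y, j, hy, hyw, hj, hyj⟩ := exists_block hw (by omega) c2
    rw [zigzag_block hy hyw hj hyj]
    unfold zigzagBlock
    split_ifs <;> simp only <;> omega
  by_cases c3 : k < w * w
  · rw [zigzag_lastRow hw (by omega) c3]
    simp only
    omega
  by_cases c4 : k ≤ w * w + w
  · rw [zigzag_topRow hw (by omega) c4]
    simp only
    omega
  · rw [zigzag_lastColumn hw (by omega)]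
    simp only
    omega

lemma exists_zigzag_eq {w m x y : ℕ} (hm : 1 ≤ m) (hmw : 3 * m ≤ w) (hx : 1 ≤ x)
    (hxw : x ≤ w + 1) (hy : 1 ≤ y) (hyw : y ≤ w + 1) :
    ∃ k < (w + 1) ^ 2, zigzag w m k = ((x : ℤ), (y : ℤ)) := by
  have hw : 1 ≤ w := by omega
  have hww : 3 * w ≤ w * w := Nat.mul_le_mul_right w (by omega)
  have hsq : (w + 1) ^ 2 = w * w + 2 * w + 1 := by ring
  rw [hsq]
  by_cases ctop : y = w + 1
  · refine ⟨w * w + x - 1, by omega, ?_⟩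
    rw [zigzag_topRow hw (by omega) (by omega)]
    ext <;> simp only <;> omega
  by_cases cright : x = w + 1
  · refine ⟨w * w + 2 * w + 1 - y, by omega, ?_⟩
    rw [zigzag_lastColumn hw (by omega)]
    ext <;> simp only <;> omega
  by_cases cleft : x ≤ m
  · by_cases clast : y = w
    · refine ⟨w * w - x, by omega, ?_⟩
      rw [zigzag_lastRow hw (by omega) (by omega)]
      ext <;> simp only <;> omega
    · have h1 : 1 * w ≤ y * w := Nat.mul_le_mul_right w hy
      have h2 : (y + 1) * w ≤ w * w := Nat.mul_le_mul_right w (by omega)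
      rw [add_mul] at h2
      refine ⟨y * w + 2 * (m - x) - m, by omega, ?_⟩
      rw [zigzag_block (y := y) (j := 2 * (m - x)) hy (by omega) (by omega) (by omega),
        zigzagBlock, if_pos (by omega), if_pos (by omega)]
      ext <;> simp only
      omega
  by_cases cfirst : y = 1
  · refine ⟨w - x, by omega, ?_⟩
    rw [zigzag_of_lt (by omega)]
    ext <;> simp only <;> omega
  obtain ⟨z, rfl⟩ : ∃ z, y = z + 1 := ⟨y - 1, by omega⟩
  have h1 : 1 * w ≤ z * w := Nat.mul_le_mul_right w (by omega)
  have h2 : (z + 1) * w ≤ w * w := Nat.mul_le_mul_right w (by omega)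
  rw [add_mul] at h2
  by_cases cmid : x ≤ w - m
  · refine ⟨z * w + (w + m - x) - m, by omega, ?_⟩
    rw [zigzag_block (y := z) (j := w + m - x) (by omega) (by omega) (by omega) (by omega),
      zigzagBlock, if_neg (by omega)]
    ext <;> simp only <;> omega
  · refine ⟨z * w + (2 * (w - x) + 1) - m, by omega, ?_⟩
    rw [zigzag_block (y := z) (j := 2 * (w - x) + 1) (by omega) (by omega) (by omega) (by omega),
      zigzagBlock, if_pos (by omega), if_neg (by omega)]
    ext <;> simp only <;> omega

lemma gridSet_eq_coe (n : ℕ) :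
    gridSet n = ((Finset.Icc (1 : ℤ) n ×ˢ Finset.Icc (1 : ℤ) n : Finset (ℤ × ℤ)) :
      Set (ℤ × ℤ)) := by
  ext p
  simp [gridSet, Prod.le_def]
  tauto

lemma injective_of_range_eq_gridSet {n : ℕ} (hn : 1 ≤ n) {f : ZMod (n ^ 2) → ℤ × ℤ}
    (h : Set.range f = gridSet n) : Function.Injective f := by
  have : NeZero (n ^ 2) := ⟨by positivity⟩
  classical
  have himage : Finset.univ.image f = Finset.Icc (1 : ℤ) n ×ˢ Finset.Icc (1 : ℤ) n := by
    apply Finset.coe_injective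
    rw [← gridSet_eq_coe, ← h]
    simp
  have hcard : (Finset.univ.image f).card = (Finset.univ : Finset (ZMod (n ^ 2))).card := by
    rw [himage, Finset.card_product, Finset.card_univ, ZMod.card]
    simp [sq]
  exact Set.injOn_univ.1 (by simpa using Finset.card_image_iff.1 hcard)

lemma zigzag_isSimpleClosedGridPolygon {w m : ℕ} (hm : 1 ≤ m) (hmw : 3 * m ≤ w) :
    IsSimpleClosedGridPolygon (w + 1) fun i => zigzag w m i.val := by
  have : NeZero ((w + 1) ^ 2) := ⟨by positivity⟩
  have hrange : (Set.range fun i : ZMod ((w + 1) ^ 2) => zigzag w m i.val) = gridSet (w + 1) := by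
    apply Set.Subset.antisymm
    · rintro _ ⟨i, rfl⟩
      exact zigzag_mem hm hmw (ZMod.val_lt i)
    · rintro ⟨x, y⟩ ⟨h1, h2, h3, h4⟩
      simp only at h1 h2 h3 h4
      lift x to ℕ using by omega
      lift y to ℕ using by omega
      obtain ⟨k, hk, hkxy⟩ := exists_zigzag_eq (x := x) (y := y) hm hmw (by omega) (by omega)
        (by omega) (by omega)
      exact ⟨(k : ZMod ((w + 1) ^ 2)), by simpa [ZMod.val_natCast, Nat.mod_eq_of_lt hk] using hkxy⟩
  refine isSimpleClosedGridPolygon_of_steps (by omega)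
    (injective_of_range_eq_gridSet (by omega) hrange) hrange (zigzagRel_ordered w m) fun i => ?_
  have hi := ZMod.val_lt i
  have hval : (i + 1).val = (i.val + 1) % (w + 1) ^ 2 := by
    rw [← ZMod.val_natCast, Nat.cast_add, ZMod.natCast_zmod_val, Nat.cast_one]
  by_cases c : i.val + 1 < (w + 1) ^ 2
  · simp only [hval, Nat.mod_eq_of_lt c]
    exact zigzag_step hm hmw c
  · have e : i.val = (w + 1) ^ 2 - 1 := by omega
    have e' : (i + 1).val = 0 := by
      rw [hval, show i.val + 1 = (w + 1) ^ 2 by omega, Nat.mod_self]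
    simp only [e, e']
    exact .inr (zigzag_step_last hm hmw)

lemma polyWeight_le {n : ℕ} {f : ZMod (n ^ 2) → ℤ × ℤ}
    (h : Set.range f = gridSet n) : polyWeight n f ≤ n ^ 2 * (n ^ 2 + n ^ 2) := by
  have hbound : ∀ i j, sqLen (f i) (f j) ≤ n ^ 2 + n ^ 2 := by
    intro i j
    have hi : f i ∈ gridSet n := h ▸ Set.mem_range_self i
    have hj : f j ∈ gridSet n := h ▸ Set.mem_range_self j
    obtain ⟨a1, a2, a3, a4⟩ := hi
    obtain ⟨b1, b2, b3, b4⟩ := hj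
    exact add_le_add (Nat.pow_le_pow_left (by omega) 2) (Nat.pow_le_pow_left (by omega) 2)
  calc polyWeight n f ≤ ∑ _i ∈ Finset.range (n ^ 2), (n ^ 2 + n ^ 2) :=
        Finset.sum_le_sum fun i _ => hbound _ _
    _ = n ^ 2 * (n ^ 2 + n ^ 2) := by simp

lemma polyWeight_le_polyA {n : ℕ} {f : ZMod (n ^ 2) → ℤ × ℤ}
    (h : IsSimpleClosedGridPolygon n f) : polyWeight n f ≤ polyA n := by
  refine le_csSup ⟨n ^ 2 * (n ^ 2 + n ^ 2), ?_⟩ ⟨f, h, rfl⟩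
  rintro _ ⟨g, hg, rfl⟩
  exact polyWeight_le hg.range_eq

lemma sum_range_two_mul_le {F : ℕ → ℕ} {a b l : ℕ} (ha : ∀ i < l, a ≤ F (2 * i))
    (hb : ∀ i < l, b ≤ F (2 * i + 1)) : l * (a + b) ≤ ∑ j ∈ Finset.range (2 * l), F j := by
  induction l with
  | zero => simp
  | succ l ih =>
    have h1 := ih (fun i hi => ha i (by omega)) (fun i hi => hb i (by omega))
    rw [show 2 * (l + 1) = 2 * l + 1 + 1 by ring, Finset.sum_range_succ, Finset.sum_range_succ]
    linarith [ha l (by omega), hb l (by omega)]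

lemma mul_le_sum_range_mul {F : ℕ → ℕ} {B w l : ℕ}
    (h : ∀ y < l, B ≤ ∑ j ∈ Finset.range w, F (y * w + j)) :
    l * B ≤ ∑ k ∈ Finset.range (l * w), F k := by
  induction l with
  | zero => simp
  | succ l ih =>
    have h1 := ih fun y hy => h y (by omega)
    rw [add_mul, one_mul, add_mul, one_mul, Finset.sum_range_add]
    exact add_le_add h1 (h l (by omega))

lemma sqLen_zigzagBlock_even {w l y i d : ℕ} (hd : w = d + l + 1) (hi : i ≤ l) :
    d ^ 2 ≤ sqLen (zigzagBlock w (l + 1) y (2 * i)) (zigzagBlock w (l + 1) y (2 * i + 1)) := by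
  refine le_trans (Nat.pow_le_pow_left ?_ 2) (Nat.le_add_right _ _)
  unfold zigzagBlock
  split_ifs <;> simp only <;> omega

lemma sqLen_zigzagBlock_odd {w l y i d : ℕ} (hd : w = d + l + 1) (hi : i < l) :
    (d + 1) ^ 2 ≤
      sqLen (zigzagBlock w (l + 1) y (2 * i + 1)) (zigzagBlock w (l + 1) y (2 * i + 2)) := by
  refine le_trans (Nat.pow_le_pow_left ?_ 2) (Nat.le_add_right _ _)
  unfold zigzagBlock
  split_ifs <;> simp only <;> omega

lemma le_polyWeight_zigzag {w l d : ℕ} (hd : w = d + l + 1) (hmw : 3 * (l + 1) ≤ w) :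
    (w - 1) * (l * (d ^ 2 + (d + 1) ^ 2) + d ^ 2) ≤
      polyWeight (w + 1) fun i => zigzag w (l + 1) i.val := by
  have hww : 3 * w ≤ w * w := Nat.mul_le_mul_right w (by omega)
  have hsq : (w + 1) ^ 2 = w * w + 2 * w + 1 := by ring
  set F : ℕ → ℕ := fun k => sqLen (zigzag w (l + 1) k) (zigzag w (l + 1) (k + 1))
  have hmul : (w - 1) * w + w = w * w := by
    rw [← Nat.succ_mul, show Nat.succ (w - 1) = w by omega]
  have hle : ∑ k ∈ Finset.range (d + (w - 1) * w), F k ≤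
      polyWeight (w + 1) fun i => zigzag w (l + 1) i.val := by
    refine le_trans (Finset.sum_le_sum fun k hk => ?_)
      (Finset.sum_le_sum_of_subset (Finset.range_subset_range.2 (by omega)))
    rw [Finset.mem_range] at hk
    have hcast : ((k : ZMod ((w + 1) ^ 2)) + 1) = ((k + 1 : ℕ) : ZMod ((w + 1) ^ 2)) := by
      push_cast
      rfl
    simp only [hcast, ZMod.val_natCast]
    rw [Nat.mod_eq_of_lt (by omega), Nat.mod_eq_of_lt (by omega)]
  refine le_trans ?_ hle
  rw [Finset.sum_range_add]
  refine le_add_left (mul_le_sum_range_mul fun y hy => ?_)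
  have hval : ∀ j < w, zigzag w (l + 1) (d + (y * w + j)) = zigzagBlock w (l + 1) (y + 1) j :=
    fun j hj => zigzag_block (by omega) (by omega) hj (by rw [add_mul]; omega)
  have hFval : ∀ j, j + 1 < w → F (d + (y * w + j)) =
      sqLen (zigzagBlock w (l + 1) (y + 1) j) (zigzagBlock w (l + 1) (y + 1) (j + 1)) := by
    intro j hj
    rw [← hval j (by omega), ← hval (j + 1) hj]
    rfl
  refine le_trans ?_ (Finset.sum_le_sum_of_subset
    (Finset.range_subset_range.2 (show 2 * l + 1 ≤ w by omega)))
  rw [Finset.sum_range_succ]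
  refine add_le_add (sum_range_two_mul_le (fun i hi => ?_) fun i hi => ?_) ?_
  · rw [hFval _ (by omega)]
    exact sqLen_zigzagBlock_even hd hi.le
  · rw [hFval _ (by omega)]
    exact sqLen_zigzagBlock_odd hd hi
  · rw [hFval _ (by omega)]
    exact sqLen_zigzagBlock_even hd le_rfl

/-- There is a constant `C > 0` with `a(n) ≥ (8/27)n⁴ − (40/27)n³ − C n²` for all `n ≥ 3`. -/
theorem polyA_ge_asymptotic :
    ∃ C : ℝ, 0 < C ∧ ∀ n : ℕ, 3 ≤ n →
      (8 / 27 : ℝ) * (n : ℝ) ^ 4 - (40 / 27 : ℝ) * (n : ℝ) ^ 3 - C * (n : ℝ) ^ 2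
        ≤ (polyA n : ℝ) := by
  refine ⟨100, by norm_num, fun n hn => ?_⟩
  obtain rfl | hn4 := hn.eq_or_lt
  · have : (0 : ℝ) ≤ (polyA 3 : ℝ) := Nat.cast_nonneg _
    norm_num
    linarith
  obtain ⟨l, r, hr, rfl⟩ : ∃ l r, r < 3 ∧ n = 3 * (l + 1) + r + 1 :=
    ⟨(n - 1) / 3 - 1, (n - 1) % 3, by omega, by omega⟩
  have hpoly := le_trans
    (le_polyWeight_zigzag (w := 3 * (l + 1) + r) (l := l) (d := 2 * (l + 1) + r) (by omega)
      (by omega))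
    (polyWeight_le_polyA (zigzag_isSimpleClosedGridPolygon (by omega) (by omega)))
  rw [show 3 * (l + 1) + r - 1 = 3 * l + 2 + r by omega] at hpoly
  have hpolyR := (Nat.cast_le (α := ℝ)).2 hpoly
  refine le_trans ?_ hpolyR
  have hl : (0 : ℝ) ≤ l := Nat.cast_nonneg l
  interval_cases r <;> push_cast <;> nlinarith [pow_nonneg hl 2, pow_nonneg hl 3]
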